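/- arXiv:0811.4488 — 2 statements merged into one kernel-verified Lean document; each statement's English description precedes it below -/
import Mathlib

section
/- For every k ≥ 0 and every x ∈ [a,b], |X^{(2k+1)}(x)| ≤ (max_{[a,b]} |1/(p u0²)|)^{k+1} · (max_{[a,b]} |r u0²|)^k · (b - a)^{2k+1} / (2k+1)!. -/
open Set MeasureTheory Filter

/-- `X̃⁽ⁿ⁾`: `X̃⁽⁰⁾ ≡ 1`; for `n ≥ 1` odd, integrate against `u0² r`; for `n` even,
against `1/(u0² p)`. -/
noncomputable def Xt (u0 p r : ℝ → ℂ) (x0 : ℝ) : ℕ → ℝ → ℂ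
  | 0 => fun _ => 1
  | n + 1 =>
    if (n + 1) % 2 = 1 then
      fun x => ∫ s in x0..x, Xt u0 p r x0 n s * (u0 s ^ 2 * r s)
    else
      fun x => ∫ s in x0..x, Xt u0 p r x0 n s / (u0 s ^ 2 * p s)

/-- `X⁽ⁿ⁾`: `X⁽⁰⁾ ≡ 1`; for `n ≥ 1` odd, integrate against `1/(u0² p)`; for `n` even,
against `u0² r`. -/
noncomputable def Xo (u0 p r : ℝ → ℂ) (x0 : ℝ) : ℕ → ℝ → ℂ
  | 0 => fun _ => 1
  | n + 1 =>
    if (n + 1) % 2 = 1 then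
      fun x => ∫ s in x0..x, Xo u0 p r x0 n s / (u0 s ^ 2 * p s)
    else
      fun x => ∫ s in x0..x, Xo u0 p r x0 n s * (u0 s ^ 2 * r s)

/-- The SPPS solution `u1 = u0 · Σ_{k=0}^∞ λ^k X̃^{(2k)}`. -/
noncomputable def u1f (u0 p r : ℝ → ℂ) (x0 : ℝ) (lam : ℂ) (x : ℝ) : ℂ :=
  u0 x * ∑' k : ℕ, lam ^ k * Xt u0 p r x0 (2 * k) x

/-- The SPPS solution `u2 = u0 · Σ_{k=0}^∞ λ^k X^{(2k+1)}`. -/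
noncomputable def u2f (u0 p r : ℝ → ℂ) (x0 : ℝ) (lam : ℂ) (x : ℝ) : ℂ :=
  u0 x * ∑' k : ℕ, lam ^ k * Xo u0 p r x0 (2 * k + 1) x

theorem norm_intervalIntegral_mul_le_pow_div_factorial {a b x₀ x C M : ℝ} {n : ℕ} {f g : ℝ → ℂ}
    (hx₀ : x₀ ∈ Set.Icc a b) (hx : x ∈ Set.Icc a b)
    (hf : ∀ s ∈ Set.Icc a b, ‖f s‖ ≤ C * |s - x₀| ^ n / n.factorial)
    (hg : ∀ s ∈ Set.Icc a b, ‖g s‖ ≤ M) :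
    ‖∫ s in x₀..x, f s * g s‖ ≤ C * M * |x - x₀| ^ (n + 1) / (n + 1).factorial := by
  have hsub : Set.uIoc x₀ x ⊆ Set.Icc a b :=
    Set.uIoc_subset_uIcc.trans (Set.uIcc_subset_Icc hx₀ hx)
  have hint : IntegrableOn (fun s => C * M / n.factorial * |s - x₀| ^ n) (Set.uIoc x₀ x) :=
    (Continuous.intervalIntegrable (by fun_prop) x₀ x).def'
  rw [intervalIntegral.norm_intervalIntegral_eq]
  calc ‖∫ s in Set.uIoc x₀ x, f s * g s‖
      ≤ ∫ s in Set.uIoc x₀ x, C * M / n.factorial * |s - x₀| ^ n := by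
        refine norm_integral_le_of_norm_le hint ?_
        refine (ae_restrict_iff' measurableSet_uIoc).2 (Eventually.of_forall fun s hs => ?_)
        have h := mul_le_mul (hf s (hsub hs)) (hg s (hsub hs)) (norm_nonneg _)
          ((norm_nonneg _).trans (hf s (hsub hs)))
        rw [norm_mul]
        exact h.trans_eq (by ring)
    _ = C * M * |x - x₀| ^ (n + 1) / (n + 1).factorial := by
        rw [integral_const_mul, integral_pow_abs_sub_uIoc, Nat.factorial_succ]
        push_cast
        field_simp

theorem Xo_odd_apply (u0 p r : ℝ → ℂ) (x0 : ℝ) (k : ℕ) (x : ℝ) :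
    Xo u0 p r x0 (2 * k + 1) x =
      ∫ s in x0..x, Xo u0 p r x0 (2 * k) s * (1 / (u0 s ^ 2 * p s)) := by
  rw [Xo, if_pos (by lia)]
  simp only [mul_one_div]

theorem Xo_even_succ_apply (u0 p r : ℝ → ℂ) (x0 : ℝ) (k : ℕ) (x : ℝ) :
    Xo u0 p r x0 (2 * (k + 1)) x =
      ∫ s in x0..x, Xo u0 p r x0 (2 * k + 1) s * (u0 s ^ 2 * r s) := by
  rw [show 2 * (k + 1) = 2 * k + 1 + 1 by ring, Xo, if_neg (by lia)]

theorem norm_Xo_odd_le {u0 p r : ℝ → ℂ} {a b x0 P R : ℝ} (hx0 : x0 ∈ Set.Icc a b)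
    (hP : ∀ s ∈ Set.Icc a b, ‖1 / (u0 s ^ 2 * p s)‖ ≤ P)
    (hR : ∀ s ∈ Set.Icc a b, ‖u0 s ^ 2 * r s‖ ≤ R) (k : ℕ) :
    ∀ x ∈ Set.Icc a b, ‖Xo u0 p r x0 (2 * k + 1) x‖ ≤
      P ^ (k + 1) * R ^ k * |x - x0| ^ (2 * k + 1) / (2 * k + 1).factorial := by
  have odd_of_even (k : ℕ) (h : ∀ x ∈ Set.Icc a b, ‖Xo u0 p r x0 (2 * k) x‖ ≤
      P ^ k * R ^ k * |x - x0| ^ (2 * k) / (2 * k).factorial) :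
      ∀ x ∈ Set.Icc a b, ‖Xo u0 p r x0 (2 * k + 1) x‖ ≤
        P ^ (k + 1) * R ^ k * |x - x0| ^ (2 * k + 1) / (2 * k + 1).factorial := by
    intro x hx
    rw [Xo_odd_apply]
    exact (norm_intervalIntegral_mul_le_pow_div_factorial hx0 hx h hP).trans_eq (by ring)
  induction k with
  | zero => exact odd_of_even 0 fun x _ => by simp [Xo]
  | succ k ih =>
    refine odd_of_even (k + 1) fun x hx => ?_
    rw [Xo_even_succ_apply]
    refine (norm_intervalIntegral_mul_le_pow_div_factorial hx0 hx ih hR).trans_eq ?_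
    rw [show 2 * (k + 1) = 2 * k + 1 + 1 by ring]
    ring

theorem ContinuousOn.norm_le_sSup_image_norm {f : ℝ → ℂ} {K : Set ℝ} (hf : ContinuousOn f K)
    (hK : IsCompact K) {s : ℝ} (hs : s ∈ K) : ‖f s‖ ≤ sSup ((fun s => ‖f s‖) '' K) :=
  le_csSup (hK.bddAbove_image hf.norm) (Set.mem_image_of_mem _ hs)

theorem Xo_odd_bound
    (a b : ℝ) (hab : a < b) (p q r u0 : ℝ → ℂ)
    (hu0ne : ∀ x ∈ Set.Icc a b, u0 x ≠ 0)
    (hu0d : ∀ x ∈ Set.Icc a b, DifferentiableAt ℝ u0 x ∧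
      DifferentiableAt ℝ (fun y => p y * deriv u0 y) x)
    (hu0sol : ∀ x ∈ Set.Icc a b, deriv (fun y => p y * deriv u0 y) x + q x * u0 x = 0)
    (hcr : ContinuousOn (fun x => u0 x ^ 2 * r x) (Set.Icc a b))
    (hcp : ContinuousOn (fun x => 1 / (u0 x ^ 2 * p x)) (Set.Icc a b))
    (x0 : ℝ) (hx0 : x0 ∈ Set.Icc a b) (hpc : ContinuousAt p x0) (hp0 : p x0 ≠ 0)
    (k : ℕ) (x : ℝ) (hx : x ∈ Set.Icc a b) :
    ‖Xo u0 p r x0 (2 * k + 1) x‖ ≤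
      (sSup ((fun s => ‖1 / (p s * u0 s ^ 2)‖) '' Set.Icc a b)) ^ (k + 1) *
      (sSup ((fun s => ‖r s * u0 s ^ 2‖) '' Set.Icc a b)) ^ k *
      (b - a) ^ (2 * k + 1) / (Nat.factorial (2 * k + 1)) := by
  simp only [mul_comm (p _), mul_comm (r _)]
  have hP := fun s hs => hcp.norm_le_sSup_image_norm isCompact_Icc (s := s) hs
  have hR := fun s hs => hcr.norm_le_sSup_image_norm isCompact_Icc (s := s) hs
  have hP0 := (norm_nonneg _).trans (hP x hx)
  have hR0 := (norm_nonneg _).trans (hR x hx)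
  refine (norm_Xo_odd_le hx0 hP hR k x hx).trans ?_
  gcongr
  exact abs_le.2 ⟨by linarith [hx.1, hx0.2], by linarith [hx.2, hx0.1]⟩
end

section
/- The characteristic function of the Dirichlet problem is entire: the power series κ(λ) = Σ_{k=0}^∞ X^{(2k+1)}(b) · λ^k converges absolutely for every λ ∈ ℂ, i.e., its radius of convergence is infinite. -/
open Set MeasureTheory Filter

/-- A bound `M` on the weight propagates the estimate
`(M (x - a)) ^ n / n!` from one iterated integral to the next. -/
lemma norm_intervalIntegral_le_pow_div_factorial {a x M : ℝ} (hax : a ≤ x) {f : ℝ → ℂ} (n : ℕ)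
    (hf : ∀ t ∈ Set.Icc a x, ‖f t‖ ≤ (M * (t - a)) ^ n / n.factorial * M) :
    ‖∫ t in a..x, f t‖ ≤ (M * (x - a)) ^ (n + 1) / (n + 1).factorial := by
  have hderiv : ∀ t ∈ Set.uIcc a x,
      HasDerivAt (fun t => (M * (t - a)) ^ (n + 1) / (n + 1).factorial)
        ((M * (t - a)) ^ n / n.factorial * M) t := by
    intro t _
    have h := (((((hasDerivAt_id t).sub_const a).const_mul M).pow (n + 1)).div_const
      ((n + 1).factorial : ℝ))
    refine h.congr_deriv ?_
    have hn : (n.factorial : ℝ) ≠ 0 := by positivity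
    have hn' : (n : ℝ) + 1 ≠ 0 := by positivity
    simp only [Nat.factorial_succ, id, Nat.add_sub_cancel]
    push_cast
    field_simp
  have hint : IntervalIntegrable (fun t => (M * (t - a)) ^ n / n.factorial * M) volume a x :=
    Continuous.intervalIntegrable (by fun_prop) a x
  calc ‖∫ t in a..x, f t‖ ≤ ∫ t in a..x, (M * (t - a)) ^ n / n.factorial * M :=
        intervalIntegral.norm_integral_le_of_norm_le hax
          (Eventually.of_forall fun t ht => hf t (Ioc_subset_Icc_self ht)) hint
    _ = (M * (x - a)) ^ (n + 1) / (n + 1).factorial := by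
        rw [intervalIntegral.integral_eq_sub_of_hasDerivAt hderiv hint]
        simp

lemma norm_Xo_le {a b M : ℝ} {u0 p r : ℝ → ℂ}
    (hr : ∀ x ∈ Set.Icc a b, ‖u0 x ^ 2 * r x‖ ≤ M)
    (hp : ∀ x ∈ Set.Icc a b, ‖1 / (u0 x ^ 2 * p x)‖ ≤ M) (n : ℕ) :
    ∀ x ∈ Set.Icc a b, ‖Xo u0 p r a n x‖ ≤ (M * (x - a)) ^ n / n.factorial := by
  induction n with
  | zero => intro x _; simp [Xo]
  | succ n ih =>
    intro x hx
    have key : ∀ w : ℝ → ℂ, (∀ t ∈ Set.Icc a b, ‖w t‖ ≤ M) →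
        ‖∫ t in a..x, Xo u0 p r a n t * w t‖ ≤ (M * (x - a)) ^ (n + 1) / (n + 1).factorial := by
      intro w hw
      refine norm_intervalIntegral_le_pow_div_factorial hx.1 n fun t ht => ?_
      have htb : t ∈ Set.Icc a b := ⟨ht.1, ht.2.trans hx.2⟩
      rw [norm_mul]
      exact mul_le_mul (ih t htb) (hw t htb) (norm_nonneg _) ((norm_nonneg _).trans (ih t htb))
    rw [Xo]
    split_ifs
    · simpa only [mul_one_div] using key _ hp
    · exact key _ hr

theorem dirichlet_characteristic_function_entire
    (a b : ℝ) (hab : a < b) (p q r u0 : ℝ → ℂ)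
    (hu0ne : ∀ x ∈ Set.Icc a b, u0 x ≠ 0)
    (hu0d : ∀ x ∈ Set.Icc a b, DifferentiableAt ℝ u0 x ∧
      DifferentiableAt ℝ (fun y => p y * deriv u0 y) x)
    (hu0sol : ∀ x ∈ Set.Icc a b, deriv (fun y => p y * deriv u0 y) x + q x * u0 x = 0)
    (hcr : ContinuousOn (fun x => u0 x ^ 2 * r x) (Set.Icc a b))
    (hcp : ContinuousOn (fun x => 1 / (u0 x ^ 2 * p x)) (Set.Icc a b))
    (hpc : ContinuousAt p a) (hp0 : p a ≠ 0)
    :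
    ∀ lam : ℂ, Summable (fun k : ℕ => ‖Xo u0 p r a (2 * k + 1) b * lam ^ k‖) := by
  intro lam
  obtain ⟨A, hA⟩ := isCompact_Icc.exists_bound_of_continuousOn hcr
  obtain ⟨B, hB⟩ := isCompact_Icc.exists_bound_of_continuousOn hcp
  have hX := norm_Xo_le (M := max A B) (fun x hx => (hA x hx).trans (le_max_left _ _))
    (fun x hx => (hB x hx).trans (le_max_right _ _))
  set C := max A B * (b - a)
  set s := max 1 ‖lam‖
  have hinj : Function.Injective fun k : ℕ => 2 * k + 1 := fun i j h => by
    simpa using h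
  refine Summable.of_nonneg_of_le (fun _ => norm_nonneg _) (fun k => ?_)
    ((Real.summable_pow_div_factorial (C * s)).comp_injective hinj)
  have hXk := hX (2 * k + 1) b (right_mem_Icc.2 hab.le)
  have hs : ‖lam‖ ^ k ≤ s ^ (2 * k + 1) :=
    (pow_le_pow_left₀ (norm_nonneg _) (le_max_right _ _) k).trans
      (pow_le_pow_right₀ (le_max_left _ _) (by lia))
  calc ‖Xo u0 p r a (2 * k + 1) b * lam ^ k‖
      = ‖Xo u0 p r a (2 * k + 1) b‖ * ‖lam‖ ^ k := by rw [norm_mul, norm_pow]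
    _ ≤ C ^ (2 * k + 1) / (2 * k + 1).factorial * s ^ (2 * k + 1) :=
        mul_le_mul hXk hs (by positivity) ((norm_nonneg _).trans hXk)
    _ = (C * s) ^ (2 * k + 1) / (2 * k + 1).factorial := by rw [mul_pow C s, div_mul_eq_mul_div]
end
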